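/- Let 𝒳 ⊆ ℬ be a σ-field with 𝒳 ⊆ T^{−1}𝒳, and define 𝒢_k^n := 𝒴_{−∞,k} ∨ T^{n−k}𝒳 for k, n ∈ ℤ. Then for every admissible strategy u and every m, n ∈ ℤ: (1/T) Σ_{k=1}^{T} (E[ℓ_k(u_k) | 𝒢_k^m] − E[ℓ_k(u_k) | 𝒢_k^n]) → 0 almost surely as T → ∞. -/

import Mathlib

open MeasureTheory Filter Set
open scoped ENNReal Topology symmDiff

noncomputable section

namespace ErgodicDecisions

variable {Ω U : Type*}

/-- The `ℤ`-indexed iterates of an invertible transformation `T` with inverse `S`: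
`iter T S n = Tⁿ` for `n ≥ 0` and `iter T S (-n) = Sⁿ`. -/
def iter (T S : Ω → Ω) : ℤ → Ω → Ω
  | Int.ofNat n => T^[n]
  | Int.negSucc n => S^[n + 1]

variable {m0 : MeasurableSpace Ω} [mU : MeasurableSpace U]

/-- The observation σ-field `𝒴_{m,n} = ⋁_{k=m}^{n} T^{-k} 𝒴`. -/
def obsField (T S : Ω → Ω) (Y : MeasurableSpace Ω) (m n : ℤ) : MeasurableSpace Ω :=
  ⨆ k ∈ Set.Icc m n, MeasurableSpace.comap (iter T S k) Y

/-- The observation σ-field `𝒴_{-∞,n} = ⋁_{k ≤ n} T^{-k} 𝒴`. -/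
def obsFieldLE (T S : Ω → Ω) (Y : MeasurableSpace Ω) (n : ℤ) : MeasurableSpace Ω :=
  ⨆ k ∈ Set.Iic n, MeasurableSpace.comap (iter T S k) Y

/-- `𝕌_{m,n}`: the set of `𝒴_{m,n}`-measurable decision maps `Ω → U`. -/
def Umn (T S : Ω → Ω) (Y : MeasurableSpace Ω) (m n : ℤ) : Set (Ω → U) :=
  {v | Measurable[obsField T S Y m n] v}

/-- `𝕌_n = ⋃_{m ≤ n} 𝕌_{m,n}`. -/
def Un (T S : Ω → Ω) (Y : MeasurableSpace Ω) (n : ℤ) : Set (Ω → U) :=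
  ⋃ m ∈ Set.Iic n, Umn T S Y m n

/-- The loss at time `n` of the decision map `v`: `ℓ_n(v)(ω) = ℓ(v(ω), Tⁿω)`. -/
def lossAt (T S : Ω → Ω) (ℓ : U → Ω → ℝ) (n : ℤ) (v : Ω → U) (ω : Ω) : ℝ :=
  ℓ (v ω) (iter T S n ω)

/-- An admissible strategy: `u_k` is `𝒴_{0,k}`-measurable for every `k ≥ 1`. -/
def Admissible (T S : Ω → Ω) (Y : MeasurableSpace Ω) (u : ℕ → Ω → U) : Prop :=
  ∀ k : ℕ, 1 ≤ k → u k ∈ Umn T S Y 0 (k : ℤ)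

/-- The time-average loss `L_T(u) = T⁻¹ ∑_{k=1}^T ℓ_k(u_k)`. -/
def avgLoss (T S : Ω → Ω) (ℓ : U → Ω → ℝ) (u : ℕ → Ω → U) (n : ℕ) (ω : Ω) : ℝ :=
  (n : ℝ)⁻¹ * ∑ k ∈ Finset.Icc 1 n, lossAt T S ℓ (k : ℤ) (u k) ω

/-- `g` is an essential infimum (an a.e.-greatest lower bound among random variables)
of the family `(f i)_{i ∈ S₀}` under `P`. -/
def IsEssInfFam {ι : Type*} (P : Measure Ω) (S₀ : Set ι) (f : ι → Ω → ℝ) (g : Ω → ℝ) : Prop :=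
  Measurable[m0] g ∧ (∀ i ∈ S₀, ∀ᵐ ω ∂P, g ω ≤ f i ω) ∧
    ∀ h : Ω → ℝ, Measurable[m0] h → (∀ i ∈ S₀, ∀ᵐ ω ∂P, h ω ≤ f i ω) → ∀ᵐ ω ∂P, h ω ≤ g ω

/-- `g` is an essential supremum (an a.e.-least upper bound among random variables)
of the family `(f i)_{i ∈ S₀}` under `P`. -/
def IsEssSupFam {ι : Type*} (P : Measure Ω) (S₀ : Set ι) (f : ι → Ω → ℝ) (g : Ω → ℝ) : Prop :=
  Measurable[m0] g ∧ (∀ i ∈ S₀, ∀ᵐ ω ∂P, f i ω ≤ g ω) ∧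
    ∀ h : Ω → ℝ, Measurable[m0] h → (∀ i ∈ S₀, ∀ᵐ ω ∂P, f i ω ≤ h ω) → ∀ᵐ ω ∂P, g ω ≤ h ω

/-- A mean-optimal strategy in the sense of Lemma 2.5 of the paper:
`E[ℓ_k(ũ_k)|𝒴_{0,k}] ≤ ess inf_{u ∈ 𝕌_{0,k}} E[ℓ_k(u)|𝒴_{0,k}] + 1/k` a.s. for all `k ≥ 1`. -/
def MeanOptimalStrategy (P : Measure Ω) (T S : Ω → Ω) (Y : MeasurableSpace Ω)
    (ℓ : U → Ω → ℝ) (ut : ℕ → Ω → U) : Prop :=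
  Admissible T S Y ut ∧
    ∀ k : ℕ, 1 ≤ k → ∃ g : Ω → ℝ,
      IsEssInfFam P (Umn T S Y 0 (k : ℤ))
        (fun v => P[lossAt T S ℓ (k : ℤ) v | obsField T S Y 0 (k : ℤ)]) g ∧
      ∀ᵐ ω ∂P, (P[lossAt T S ℓ (k : ℤ) (ut k) | obsField T S Y 0 (k : ℤ)]) ω ≤ g ω + (k : ℝ)⁻¹

/-- Pathwise optimality (Definition 2.2). -/
def PathwiseOptimal (P : Measure Ω) (T S : Ω → Ω) (Y : MeasurableSpace Ω)
    (ℓ : U → Ω → ℝ) (us : ℕ → Ω → U) : Prop :=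
  Admissible T S Y us ∧
    ∀ u : ℕ → Ω → U, Admissible T S Y u →
      ∀ᵐ ω ∂P,
        0 ≤ Filter.liminf (fun n : ℕ => avgLoss T S ℓ u n ω - avgLoss T S ℓ us n ω) atTop

/-- Weak pathwise optimality (Definition 2.3). -/
def WeaklyPathwiseOptimal (P : Measure Ω) (T S : Ω → Ω) (Y : MeasurableSpace Ω)
    (ℓ : U → Ω → ℝ) (us : ℕ → Ω → U) : Prop :=
  Admissible T S Y us ∧
    ∀ u : ℕ → Ω → U, Admissible T S Y u → ∀ ε : ℝ, 0 < ε →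
      Tendsto (fun n : ℕ => P {ω | -ε ≤ avgLoss T S ℓ u n ω - avgLoss T S ℓ us n ω})
        atTop (𝓝 1)

/-- Mean optimality (Definition 2.4). -/
def MeanOptimal (P : Measure Ω) (T S : Ω → Ω) (Y : MeasurableSpace Ω)
    (ℓ : U → Ω → ℝ) (us : ℕ → Ω → U) : Prop :=
  Admissible T S Y us ∧
    ∀ u : ℕ → Ω → U, Admissible T S Y u →
      0 ≤ Filter.liminf
        (fun n : ℕ => (∫ ω, avgLoss T S ℓ u n ω ∂P) - ∫ ω, avgLoss T S ℓ us n ω ∂P) atTop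

/-- Two σ-fields on `Ω` agree modulo `P`-null sets. -/
def EqModP (P : Measure Ω) (m₁ m₂ : MeasurableSpace Ω) : Prop :=
  (∀ A : Set Ω, MeasurableSet[m₁] A → ∃ B : Set Ω, MeasurableSet[m₂] B ∧ P (A ∆ B) = 0) ∧
    ∀ A : Set Ω, MeasurableSet[m₂] A → ∃ B : Set Ω, MeasurableSet[m₁] B ∧ P (A ∆ B) = 0

/-- Conditional K-automorphism relative to `Z` (Definition 1.4); `S` is the inverse of `T`,
so that `T^{-k}𝒳 = comap T^k 𝒳` and `T^{k}𝒳 = comap S^k 𝒳`. -/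
def CondK (P : Measure Ω) (T S : Ω → Ω) (Z : MeasurableSpace Ω) : Prop :=
  ∃ X : MeasurableSpace Ω, X ≤ m0 ∧
    X ≤ MeasurableSpace.comap T X ∧
    EqModP P (⨆ k : ℕ, MeasurableSpace.comap (T^[k + 1]) X) m0 ∧
    EqModP P (⨅ k : ℕ, Z ⊔ MeasurableSpace.comap (S^[k + 1]) X) Z

/-- Conditional weak mixing relative to `Z` (Definition 1.3); `S` is the inverse of `T`,
so that `T^k B = (S^[k])⁻¹ B`. -/
def CondWeakMixing (P : Measure Ω) (S : Ω → Ω) (Z : MeasurableSpace Ω) : Prop :=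
  ∀ A B : Set Ω, MeasurableSet[m0] A → MeasurableSet[m0] B →
    Tendsto
      (fun n : ℕ => ∫ ω,
        (n : ℝ)⁻¹ * ∑ k ∈ Finset.Icc 1 n,
          |(P[(A ∩ S^[k] ⁻¹' B).indicator (fun _ => (1 : ℝ)) | Z]) ω -
            (P[A.indicator (fun _ => (1 : ℝ)) | Z]) ω *
              (P[(S^[k] ⁻¹' B).indicator (fun _ => (1 : ℝ)) | Z]) ω| ∂P)
      atTop (𝓝 0)

/-- The tail σ-field `⋂_{k≥1} (𝒴_{-∞,0} ∨ T^k 𝒳)`. -/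
def tailField (T S : Ω → Ω) (Y X : MeasurableSpace Ω) : MeasurableSpace Ω :=
  ⨅ k : ℕ, obsFieldLE T S Y 0 ⊔ MeasurableSpace.comap (S^[k + 1]) X

/-- The truncated loss `ℓ_0(v)·1_{Λ ≤ M}`. -/
def truncLoss (ℓ : U → Ω → ℝ) (Λ : Ω → ℝ) (M : ℝ) (v : Ω → U) (ω : Ω) : ℝ :=
  if Λ ω ≤ M then ℓ (v ω) ω else 0

/-- `ℓ̄_0^M(v) = ℓ_0(v)·1_{Λ≤M} − E[ℓ_0(v)·1_{Λ≤M} | 𝒴_{-∞,0}]`. -/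
def barLoss (P : Measure Ω) (T S : Ω → Ω) (Y : MeasurableSpace Ω)
    (ℓ : U → Ω → ℝ) (Λ : Ω → ℝ) (M : ℝ) (v : Ω → U) (ω : Ω) : ℝ :=
  truncLoss ℓ Λ M v ω - (P[truncLoss ℓ Λ M v | obsFieldLE T S Y 0]) ω

/-- The uniform conditional mixing assumption of Theorem 2.12:
`lim_{M→∞} limsup_{T→∞} E[(1/T)∑_{k=1}^T ess sup_{u,u'∈𝕌₀}
|E[(ℓ̄₀^M(u)∘T^{-k})·ℓ̄₀^M(u')|𝒴_{-∞,0}]|] = 0`. -/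
def UniformCondMixing (P : Measure Ω) (T S : Ω → Ω) (Y : MeasurableSpace Ω)
    (ℓ : U → Ω → ℝ) (Λ : Ω → ℝ) : Prop :=
  ∃ G : ℝ → ℕ → Ω → ℝ,
    (∀ (M : ℝ) (k : ℕ),
      IsEssSupFam P ((Un T S Y 0) ×ˢ (Un T S Y 0))
        (fun p ω =>
          |(P[(fun ω' => barLoss P T S Y ℓ Λ M p.1 (S^[k] ω') *
                barLoss P T S Y ℓ Λ M p.2 ω') | obsFieldLE T S Y 0]) ω|)
        (G M k)) ∧
    Tendsto
      (fun M : ℝ =>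
        Filter.limsup
          (fun n : ℕ => ∫ ω, (n : ℝ)⁻¹ * ∑ k ∈ Finset.Icc 1 n, G M k ω ∂P) atTop)
      atTop (𝓝 0)

/-- Equimeasurability of the loss (Definition 3.1): for every `ε > 0` there is a set of
probability at least `1-ε` on which the family `{ℓ(u,·) : u ∈ U}` is totally bounded
in `L^∞(P)`. -/
def Equimeasurable (P : Measure Ω) (ℓ : U → Ω → ℝ) : Prop :=
  ∀ ε : ℝ, 0 < ε → ∃ Ωε : Set Ω, MeasurableSet[m0] Ωε ∧ 1 - ENNReal.ofReal ε ≤ P Ωε ∧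
    ∀ δ : ℝ, 0 < δ → ∃ 𝒩 : Finset (Ω → ℝ), ∀ u : U, ∃ f ∈ 𝒩,
      eLpNorm (fun ω => Ωε.indicator (ℓ u) ω - f ω) ⊤ P ≤ ENNReal.ofReal δ


section Helpers

lemma kronecker_aux (d : ℕ → ℝ) (N : ℕ) :
    ∑ k ∈ Finset.range N, d k = N * (∑ k ∈ Finset.range N, d k / ((k : ℝ) + 1)) -
      ∑ j ∈ Finset.range N, ∑ k ∈ Finset.range j, d k / ((k : ℝ) + 1) := by
  induction N with
  | zero => simp
  | succ N ih =>
    rw [Finset.sum_range_succ, ih, Finset.sum_range_succ (fun k => d k / ((k : ℝ) + 1)),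
      Finset.sum_range_succ (fun j => ∑ k ∈ Finset.range j, d k / ((k : ℝ) + 1))]
    have : (N : ℝ) + 1 ≠ 0 := by positivity
    push_cast
    field_simp
    ring

lemma kronecker (d : ℕ → ℝ) (c : ℝ)
    (h : Tendsto (fun N : ℕ => ∑ k ∈ Finset.range N, d k / ((k : ℝ) + 1)) atTop (𝓝 c)) :
    Tendsto (fun N : ℕ => (N : ℝ)⁻¹ * ∑ k ∈ Finset.range N, d k) atTop (𝓝 0) := by
  have h2 := h.sub h.cesaro
  rw [sub_self] at h2
  refine h2.congr' ?_
  filter_upwards [eventually_ge_atTop 1] with N hN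
  have : (N : ℝ) ≠ 0 := by positivity
  rw [kronecker_aux d N]
  field_simp

lemma mds_slln {α : Type*} {mα : MeasurableSpace α} (μ : Measure α) [IsProbabilityMeasure μ]
    (F : Filtration ℕ mα) (d : ℕ → α → ℝ) (C : ℝ)
    (hd : ∀ k, StronglyMeasurable[F (k + 1)] (d k))
    (hC : ∀ k, ∀ᵐ ω ∂μ, |d k ω| ≤ C)
    (h0 : ∀ k, μ[d k | F k] =ᵐ[μ] 0) :
    ∀ᵐ ω ∂μ, Tendsto (fun N : ℕ => (N : ℝ)⁻¹ * ∑ k ∈ Finset.range N, d k ω) atTop (𝓝 0) := by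
  have hdtop : ∀ k, MemLp (d k) ⊤ μ := fun k =>
    memLp_top_of_bound (((hd k).mono (F.le _)).aestronglyMeasurable) C
      (by simpa [Real.norm_eq_abs] using hC k)
  set e : ℕ → α → ℝ := fun k ω => d k ω / ((k : ℝ) + 1) with he
  have hee : ∀ k, e k = ((k : ℝ) + 1)⁻¹ • d k := by
    intro k; ext ω; simp [he, div_eq_inv_mul]
  have hetop : ∀ k, MemLp (e k) ⊤ μ := fun k => by
    rw [hee]; exact (hdtop k).const_smul _
  have hesm : ∀ k, StronglyMeasurable[F (k + 1)] (e k) := fun k => by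
    rw [hee]; exact (hd k).const_smul _
  have he0 : ∀ k, μ[e k | F k] =ᵐ[μ] 0 := fun k => by
    rw [hee]
    filter_upwards [condExp_smul (μ := μ) ((k : ℝ) + 1)⁻¹ (d k) (F k), h0 k] with ω h1 h2
    rw [h1]; simp [h2]
  set M : ℕ → α → ℝ := fun N ω => ∑ k ∈ Finset.range N, e k ω with hM
  have hMtop : ∀ N, MemLp (M N) ⊤ μ := fun N =>
    memLp_finsetSum _ (fun k _ => hetop k)
  have hMsm : StronglyAdapted F M := fun N => by
    refine Finset.stronglyMeasurable_fun_sum _ fun k hk => ?_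
    exact (hesm k).mono (F.mono (Finset.mem_range.1 hk))
  have hMsucc : ∀ N, M (N + 1) = M N + e N := fun N => by
    ext ω; simp [hM, Finset.sum_range_succ]
  have hMint : ∀ N, Integrable (M N) μ := fun N => (hMtop N).integrable le_top
  have hmart : Martingale M F μ := by
    refine martingale_of_condExp_sub_eq_zero_nat hMsm hMint fun N => ?_
    have : M (N + 1) - M N = e N := by rw [hMsucc]; simp
    rw [this]; exact he0 N
  have hsum : Summable fun k : ℕ => 1 / ((k : ℝ) + 1) ^ 2 := by
    have := (summable_nat_add_iff 1).2 (Real.summable_one_div_nat_pow (p := 2).2 one_lt_two)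
    simpa using this
  have hi2 : ∀ {f g : α → ℝ}, MemLp f ⊤ μ → MemLp g ⊤ μ → Integrable (fun ω => f ω * g ω) μ :=
    fun hf hg => (hg.mul (r := ⊤) hf).integrable le_top
  have hL2 : ∀ N, ∫ ω, M N ω * M N ω ∂μ ≤ ∑ k ∈ Finset.range N, C ^ 2 * (1 / ((k : ℝ) + 1) ^ 2) := by
    intro N
    induction N with
    | zero => simp [hM]
    | succ N ih =>
      have hcross : ∫ ω, M N ω * e N ω ∂μ = 0 := by
        have h1 := condExp_mul_of_stronglyMeasurable_left (μ := μ) (hMsm N)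
          (hi2 (hMtop N) (hetop N)) ((hetop N).integrable le_top)
        have h2 : ∫ ω, M N ω * e N ω ∂μ = ∫ ω, (μ[M N * e N | F N]) ω ∂μ :=
          (integral_condExp (F.le N)).symm
        rw [h2, integral_congr_ae (g := fun _ => (0 : ℝ))]
        · simp
        · filter_upwards [h1, he0 N] with ω h1 h3
          rw [h1]; simp [h3]
      have hsq : ∫ ω, e N ω * e N ω ∂μ ≤ C ^ 2 * (1 / ((N : ℝ) + 1) ^ 2) := by
        have : ∫ ω, e N ω * e N ω ∂μ ≤ ∫ ω, C ^ 2 * (1 / ((N : ℝ) + 1) ^ 2) ∂μ := by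
          refine integral_mono_ae (hi2 (hetop N) (hetop N)) (integrable_const _) ?_
          filter_upwards [hC N] with ω hω
          have h3 : d N ω ^ 2 ≤ C ^ 2 := sq_le_sq' (by linarith [neg_abs_le (d N ω)])
            ((le_abs_self _).trans hω)
          have h4 : e N ω * e N ω = d N ω ^ 2 * (1 / ((N : ℝ) + 1) ^ 2) := by
            simp only [he]; field_simp
          simp only [h4]
          gcongr
        simpa using this
      rw [Finset.sum_range_succ]
      have : ∫ ω, M (N + 1) ω * M (N + 1) ω ∂μ =
          ∫ ω, M N ω * M N ω ∂μ + 2 * ∫ ω, M N ω * e N ω ∂μ + ∫ ω, e N ω * e N ω ∂μ := by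
        have hadd : Integrable (fun ω => M N ω * M N ω + 2 * (M N ω * e N ω)) μ :=
          (hi2 (hMtop N) (hMtop N)).add ((hi2 (hMtop N) (hetop N)).const_mul 2)
        rw [← integral_const_mul, ← integral_add (hi2 (hMtop N) (hMtop N))
          ((hi2 (hMtop N) (hetop N)).const_mul 2), ← integral_add hadd
          (hi2 (hetop N) (hetop N))]
        congr 1; ext ω; rw [hMsucc]; simp; ring
      rw [this, hcross]; linarith
  set K : ℝ := 1 + ∑' k : ℕ, C ^ 2 * (1 / ((k : ℝ) + 1) ^ 2) with hK
  have hbdd : ∀ N, eLpNorm (M N) 1 μ ≤ (K.toNNReal : ℝ≥0∞) := by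
    intro N
    rw [eLpNorm_one_eq_lintegral_enorm, ← ofReal_integral_norm_eq_lintegral_enorm (hMint N)]
    refine ENNReal.ofReal_le_ofReal ?_
    have h1 : ∫ ω, ‖M N ω‖ ∂μ ≤ ∫ ω, (1 + M N ω * M N ω) ∂μ := by
      refine integral_mono (hMint N).norm ((integrable_const _).add (hi2 (hMtop N) (hMtop N)))
        fun ω => ?_
      simp only [Real.norm_eq_abs]
      nlinarith [sq_nonneg (|M N ω| - 1), abs_mul_abs_self (M N ω), abs_nonneg (M N ω)]
    rw [integral_add (integrable_const _) (hi2 (hMtop N) (hMtop N))] at h1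
    have h2 := (hsum.mul_left (C ^ 2)).sum_le_tsum (Finset.range N) (fun k _ => by positivity)
    have h3 := hL2 N
    simp at h1
    simp only [hK, Real.norm_eq_abs]
    linarith
  filter_upwards [hmart.submartingale.exists_ae_tendsto_of_bdd hbdd] with ω hω
  obtain ⟨c, hc⟩ := hω
  exact kronecker (fun k => d k ω) c hc

/-- Auxiliary running maximum in the proof of the maximal ergodic inequality. -/
def maxProc {α : Type*} (T : α → α) (g : α → ℝ) : ℕ → α → ℝ
  | 0 => fun _ => 0
  | n + 1 => fun ω => max 0 (g ω + maxProc T g n (T ω))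

lemma maxProc_nonneg {α : Type*} (T : α → α) (g : α → ℝ) (n : ℕ) (ω : α) :
    0 ≤ maxProc T g n ω := by
  cases n <;> simp [maxProc]

lemma maxProc_mono {α : Type*} (T : α → α) (g : α → ℝ) (n : ℕ) :
    ∀ ω, maxProc T g n ω ≤ maxProc T g (n + 1) ω := by
  induction n with
  | zero => intro ω; simp [maxProc]
  | succ n ih =>
    intro ω
    rw [maxProc, maxProc]
    exact max_le_max le_rfl (by linarith [ih (T ω)])

lemma sum_le_maxProc {α : Type*} (T : α → α) (g : α → ℝ) (n : ℕ) :
    ∀ ω, ∑ i ∈ Finset.range n, g (T^[i] ω) ≤ maxProc T g n ω := by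
  induction n with
  | zero => intro ω; simp [maxProc]
  | succ n ih =>
    intro ω
    rw [Finset.sum_range_succ', maxProc]
    refine le_max_of_le_right ?_
    have := ih (T ω)
    simp only [Function.iterate_succ, Function.comp, Function.iterate_zero, id] at *
    linarith

lemma maxProc_measurable {α : Type*} {mα : MeasurableSpace α} {T : α → α} {g : α → ℝ}
    (hT : Measurable T) (hg : Measurable g) (n : ℕ) : Measurable (maxProc T g n) := by
  induction n with
  | zero => exact measurable_const
  | succ n ih => exact measurable_const.max (hg.add (ih.comp hT))

lemma maxProc_integrable {α : Type*} {mα : MeasurableSpace α} {μ : Measure α} {T : α → α}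
    {g : α → ℝ} (hT : MeasurePreserving T μ μ) (hg : Integrable g μ) (n : ℕ) :
    Integrable (maxProc T g n) μ := by
  induction n with
  | zero => exact integrable_zero _ _ _
  | succ n ih =>
    exact (integrable_zero _ _ _).sup (hg.add ((hT.integrable_comp ih.aestronglyMeasurable).2 ih))

lemma maximal_garsia {α : Type*} {mα : MeasurableSpace α} {μ : Measure α} {T : α → α}
    {g : α → ℝ} (hT : MeasurePreserving T μ μ) (hgm : Measurable g) (hg : Integrable g μ)
    (n : ℕ) : 0 ≤ ∫ ω in {ω | 0 < maxProc T g n ω}, g ω ∂μ := by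
  cases n with
  | zero => simp [maxProc]
  | succ n =>
    have hAm : MeasurableSet {ω | 0 < maxProc T g (n + 1) ω} :=
      measurableSet_lt measurable_const (maxProc_measurable hT.measurable hgm _)
    have hi := maxProc_integrable hT hg n
    have hic : Integrable (fun ω => maxProc T g n (T ω)) μ :=
      (hT.integrable_comp hi.aestronglyMeasurable).2 hi
    have h1 : ∫ ω, maxProc T g (n + 1) ω ∂μ ≤
        ∫ ω, ({ω | 0 < maxProc T g (n + 1) ω}.indicator g ω + maxProc T g n (T ω)) ∂μ := by
      refine integral_mono (maxProc_integrable hT hg _) ((hg.indicator hAm).add hic) fun ω => ?_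
      by_cases hω : 0 < maxProc T g (n + 1) ω
      · have : ω ∈ {ω | 0 < maxProc T g (n + 1) ω} := hω
        simp only [Set.indicator_of_mem this]
        rw [maxProc] at hω ⊢
        rcases lt_max_iff.1 hω with h | h
        · exact absurd h (lt_irrefl _)
        · exact (max_eq_right h.le).le
      · have : ω ∉ {ω | 0 < maxProc T g (n + 1) ω} := hω
        simp only [Set.indicator_of_notMem this]
        linarith [maxProc_nonneg T g n (T ω)]
    rw [integral_add (hg.indicator hAm) hic, integral_indicator hAm] at h1
    have h2 : ∫ ω, maxProc T g n (T ω) ∂μ = ∫ ω, maxProc T g n ω ∂μ := by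
      have := integral_map (μ := μ) hT.measurable.aemeasurable
        (f := maxProc T g n) (by rw [hT.map_eq]; exact hi.aestronglyMeasurable)
      rw [hT.map_eq] at this
      exact this.symm
    have h3 := integral_mono hi (maxProc_integrable hT hg (n + 1)) (maxProc_mono T g n)
    linarith

lemma maximal_ineq {α : Type*} {mα : MeasurableSpace α} {μ : Measure α} [IsProbabilityMeasure μ]
    {T : α → α} {g : α → ℝ} (hT : MeasurePreserving T μ μ) (hgm : Measurable g)
    (hg : Integrable g μ) (hg0 : ∀ ω, 0 ≤ g ω) (ε : ℝ) (hε : 0 < ε) :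
    μ {ω | ∃ N : ℕ, ε * N < ∑ i ∈ Finset.range N, g (T^[i] ω)} ≤
      ENNReal.ofReal ((∫ ω, g ω ∂μ) / ε) := by
  set g' : α → ℝ := fun ω => g ω - ε with hg'
  have hg'm : Measurable g' := hgm.sub measurable_const
  have hg'i : Integrable g' μ := hg.sub (integrable_const _)
  set A : ℕ → Set α := fun n => {ω | 0 < maxProc T g' n ω} with hA
  have hAm : ∀ n, MeasurableSet (A n) := fun n =>
    measurableSet_lt measurable_const (maxProc_measurable hT.measurable hg'm n)
  have hAmono : Monotone A := monotone_nat_of_le_succ fun n ω hω =>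
    lt_of_lt_of_le (show 0 < maxProc T g' n ω from hω) (maxProc_mono T g' n ω)
  have hsub : {ω | ∃ N : ℕ, ε * N < ∑ i ∈ Finset.range N, g (T^[i] ω)} ⊆ ⋃ n, A n := by
    rintro ω ⟨N, hN⟩
    refine mem_iUnion.2 ⟨N, lt_of_lt_of_le ?_ (sum_le_maxProc T g' N ω)⟩
    simp only [hg', Finset.sum_sub_distrib, Finset.sum_const, Finset.card_range, nsmul_eq_mul]
    linarith
  refine (measure_mono hsub).trans ?_
  rw [hAmono.measure_iUnion]
  refine iSup_le fun n => ?_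
  have h1 : 0 ≤ ∫ ω in A n, g' ω ∂μ := maximal_garsia hT hg'm hg'i n
  rw [integral_sub hg.integrableOn (integrable_const _).integrableOn] at h1
  have h2 : ∫ ω in A n, g ω ∂μ ≤ ∫ ω, g ω ∂μ :=
    setIntegral_le_integral hg (Eventually.of_forall hg0)
  simp at h1
  rw [← ENNReal.ofReal_toReal (measure_ne_top μ (A n))]
  refine ENNReal.ofReal_le_ofReal ?_
  rw [le_div_iff₀ hε]
  have : (μ (A n)).toReal = μ.real (A n) := rfl
  rw [this]
  linarith

lemma avg_tendsto_of_approx {α : Type*} {mα : MeasurableSpace α} {μ : Measure α}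
    [IsProbabilityMeasure μ] {T : α → α} (hT : MeasurePreserving T μ μ) (x : ℕ → α → ℝ)
    (H : ∀ δ : ℝ, 0 < δ → ∃ (a b : ℕ → α → ℝ) (g : α → ℝ),
      (∀ k, ∀ᵐ ω ∂μ, x k ω = a k ω + b k ω) ∧
      (∀ᵐ ω ∂μ, Tendsto (fun N : ℕ => (N : ℝ)⁻¹ * ∑ k ∈ Finset.range N, a k ω) atTop (𝓝 0)) ∧
      (∀ k, ∀ᵐ ω ∂μ, |b k ω| ≤ g (T^[k] ω)) ∧ Measurable g ∧ Integrable g μ ∧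
      (∀ ω, 0 ≤ g ω) ∧ ∫ ω, g ω ∂μ ≤ δ) :
    ∀ᵐ ω ∂μ, Tendsto (fun N : ℕ => (N : ℝ)⁻¹ * ∑ k ∈ Finset.range N, x k ω) atTop (𝓝 0) := by
  have key : ∀ ε : ℝ, 0 < ε → ∀ᵐ ω ∂μ, ∀ᶠ N : ℕ in atTop,
      |(N : ℝ)⁻¹ * ∑ k ∈ Finset.range N, x k ω| < 2 * ε := by
    intro ε hε
    rw [ae_iff]
    refine le_antisymm (ENNReal.le_of_forall_pos_le_add fun η hη _ => ?_) zero_le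
    obtain ⟨a, b, g, hx, ha, hb, hgm, hgi, hg0, hgδ⟩ := H (η * ε) (by positivity)
    have hbad := maximal_ineq hT hgm hgi hg0 ε hε
    rw [zero_add]
    refine le_trans (measure_mono_ae ?_) (hbad.trans ?_)
    · filter_upwards [ae_all_iff.2 hx, ha, ae_all_iff.2 hb] with ω h1 h2 h3 h4
      by_contra hcon
      apply h4
      have hcon' : ∀ N : ℕ, ∑ i ∈ Finset.range N, g (T^[i] ω) ≤ ε * N := by
        intro N
        by_contra hN
        exact hcon ⟨N, not_le.1 hN⟩
      have h5 : ∀ᶠ N : ℕ in atTop, |(N : ℝ)⁻¹ * ∑ k ∈ Finset.range N, a k ω| < ε := by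
        have := (Metric.tendsto_nhds.1 h2) ε hε
        simpa [Real.dist_eq] using this
      filter_upwards [h5, eventually_ge_atTop 1] with N hN hN1
      have hNpos : (0 : ℝ) < N := by exact_mod_cast hN1
      have h6 : |∑ k ∈ Finset.range N, b k ω| ≤ ε * N :=
        (Finset.abs_sum_le_sum_abs _ _).trans
          ((Finset.sum_le_sum fun k _ => h3 k).trans (hcon' N))
      have h7 : |(N : ℝ)⁻¹ * ∑ k ∈ Finset.range N, b k ω| ≤ ε := by
        rw [abs_mul, abs_of_pos (inv_pos.2 hNpos), inv_mul_le_iff₀ hNpos]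
        linarith
      have h8 : (N : ℝ)⁻¹ * ∑ k ∈ Finset.range N, x k ω =
          (N : ℝ)⁻¹ * ∑ k ∈ Finset.range N, a k ω + (N : ℝ)⁻¹ * ∑ k ∈ Finset.range N, b k ω := by
        rw [← mul_add, ← Finset.sum_add_distrib]
        simp only [h1]
      rw [h8]
      linarith [abs_add_le ((N : ℝ)⁻¹ * ∑ k ∈ Finset.range N, a k ω)
        ((N : ℝ)⁻¹ * ∑ k ∈ Finset.range N, b k ω)]
    · rw [← ENNReal.ofReal_coe_nnreal]
      refine ENNReal.ofReal_le_ofReal ?_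
      rw [div_le_iff₀ hε]; exact hgδ
  have key2 : ∀ᵐ ω ∂μ, ∀ j : ℕ, ∀ᶠ N : ℕ in atTop,
      |(N : ℝ)⁻¹ * ∑ k ∈ Finset.range N, x k ω| < 2 * (1 / ((j : ℝ) + 1)) :=
    ae_all_iff.2 fun j => key _ (by positivity)
  filter_upwards [key2] with ω hω
  rw [Metric.tendsto_nhds]
  intro ε hε
  obtain ⟨j, hj⟩ := exists_nat_one_div_lt (half_pos hε)
  filter_upwards [hω j] with N hN
  simp only [Real.dist_eq, sub_zero]
  linarith

lemma condExp_comp_mp {α : Type*} (m : MeasurableSpace α) {mα : MeasurableSpace α}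
    {μ : Measure α} [IsProbabilityMeasure μ] {T : α → α} (hT : MeasurePreserving T μ μ)
    (hm : m ≤ mα) (f : α → ℝ) (hf : Integrable f μ) :
    μ[fun ω => f (T ω) | m.comap T] =ᵐ[μ] fun ω => (μ[f | m]) (T ω) := by
  have hle : m.comap T ≤ mα := by
    rintro s ⟨t, ht, rfl⟩
    exact hT.measurable (hm _ ht)
  have hfc : Integrable (fun ω => f (T ω)) μ := (hT.integrable_comp hf.aestronglyMeasurable).2 hf
  have hcc : Integrable (fun ω => (μ[f | m]) (T ω)) μ :=
    (hT.integrable_comp integrable_condExp.aestronglyMeasurable).2 integrable_condExp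
  refine (ae_eq_condExp_of_forall_setIntegral_eq hle hfc (fun s _ _ => hcc.integrableOn) ?_ ?_).symm
  · rintro s ⟨t, ht, rfl⟩ _
    have e1 : ∀ φ : α → ℝ, Integrable φ μ →
        ∫ ω in T ⁻¹' t, φ (T ω) ∂μ = ∫ ω in t, φ ω ∂μ := fun φ hφ => by
      have := setIntegral_map (μ := μ) (g := T) (f := φ) (hm _ ht)
        (by rw [hT.map_eq]; exact hφ.aestronglyMeasurable) hT.measurable.aemeasurable
      rw [hT.map_eq] at this
      exact this.symm
    rw [e1 _ integrable_condExp, e1 _ hf, setIntegral_condExp hm hf ht]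
  · refine StronglyMeasurable.aestronglyMeasurable ?_
    exact (stronglyMeasurable_condExp (m := m)).comp_measurable
      (comap_measurable T)


lemma iter_eq_zpow {α : Type*} (T S : α → α) (e : Equiv.Perm α) (h1 : ⇑e = T) (h2 : ⇑e.symm = S)
    (j : ℤ) : iter T S j = ⇑(e ^ j) := by
  cases j with
  | ofNat n =>
    rw [Int.ofNat_eq_natCast, zpow_natCast, Equiv.Perm.coe_pow, h1]; rfl
  | negSucc n =>
    rw [zpow_negSucc, ← inv_pow, Equiv.Perm.coe_pow]
    have : ⇑(e⁻¹) = S := h2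
    rw [this]; rfl

lemma iter_add {α : Type*} {T S : α → α} (hST : Function.LeftInverse S T)
    (hTS : Function.RightInverse S T) (i j : ℤ) :
    iter T S i ∘ iter T S j = iter T S (i + j) := by
  have h := iter_eq_zpow T S ⟨T, S, hST, hTS⟩ rfl rfl
  rw [h, h, h, zpow_add]; rfl

lemma iter_natCast {α : Type*} (T S : α → α) (k : ℕ) : iter T S (k : ℤ) = T^[k] := rfl

lemma iter_mp {α : Type*} {mα : MeasurableSpace α} {μ : Measure α} {T S : α → α}
    (hT : MeasurePreserving T μ μ) (hS : MeasurePreserving S μ μ) (j : ℤ) :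
    MeasurePreserving (iter T S j) μ μ := by
  cases j with
  | ofNat n => exact hT.iterate n
  | negSucc n => exact hS.iterate (n + 1)

/-- The σ-field `𝒢ₖⁿ`. -/
abbrev GG {α : Type*} (T S : α → α) (Y X : MeasurableSpace α) (k n : ℤ) : MeasurableSpace α :=
  obsFieldLE T S Y k ⊔ MeasurableSpace.comap (iter T S (k - n)) X

lemma obsFieldLE_mono {α : Type*} (T S : α → α) (Y : MeasurableSpace α) {i j : ℤ} (h : i ≤ j) :
    obsFieldLE T S Y i ≤ obsFieldLE T S Y j :=
  biSup_mono fun _ hk => le_trans hk h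

lemma comap_iter_mono {α : Type*} {T S : α → α} (hST : Function.LeftInverse S T)
    (hTS : Function.RightInverse S T) {X : MeasurableSpace α}
    (hX1 : X ≤ MeasurableSpace.comap T X) (j : ℤ) :
    MeasurableSpace.comap (iter T S j) X ≤ MeasurableSpace.comap (iter T S (j + 1)) X := by
  refine (MeasurableSpace.comap_mono hX1).trans ?_
  rw [MeasurableSpace.comap_comp, add_comm, ← iter_add hST hTS]
  exact le_rfl

lemma comap_GG {α : Type*} {T S : α → α} (hST : Function.LeftInverse S T)
    (hTS : Function.RightInverse S T) (Y X : MeasurableSpace α) (k n : ℤ) :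
    MeasurableSpace.comap (iter T S k) (GG T S Y X 0 n) = GG T S Y X k n := by
  unfold GG obsFieldLE
  simp only [MeasurableSpace.comap_sup, MeasurableSpace.comap_iSup, MeasurableSpace.comap_comp,
    iter_add hST hTS]
  congr 1
  · apply le_antisymm
    · refine iSup₂_le fun i hi => ?_
      exact le_iSup₂_of_le (f := fun j (_ : j ∈ Set.Iic k) => MeasurableSpace.comap (iter T S j) Y)
        (i + k) (by simpa using hi) le_rfl
    · refine iSup₂_le fun i hi => ?_
      refine le_iSup₂_of_le (f := fun j (_ : j ∈ Set.Iic (0 : ℤ)) =>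
        MeasurableSpace.comap (iter T S (j + k)) Y) (i - k) (by simpa using hi) ?_
      simp
  · congr 2; ring

lemma obsField_le_m {α : Type*} (Y : MeasurableSpace α) {mα : MeasurableSpace α} {T S : α → α}
    (hi : ∀ j, Measurable (iter T S j)) (hY : Y ≤ mα) (i j : ℤ) : obsField T S Y i j ≤ mα :=
  iSup₂_le fun k _ => (MeasurableSpace.comap_mono hY).trans (hi k).comap_le

lemma GG_le_m {α : Type*} (Y X : MeasurableSpace α) {mα : MeasurableSpace α} {T S : α → α}
    (hi : ∀ j, Measurable (iter T S j)) (hY : Y ≤ mα) (hX : X ≤ mα) (k n : ℤ) :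
    GG T S Y X k n ≤ mα :=
  sup_le (iSup₂_le fun k _ => (MeasurableSpace.comap_mono hY).trans (hi k).comap_le)
    ((MeasurableSpace.comap_mono hX).trans (hi _).comap_le)

/-- Clipping a real number to `[-C, C]`. -/
def clip (C x : ℝ) : ℝ := max (-C) (min C x)

lemma clip_abs_le {C : ℝ} (hC : 0 ≤ C) (x : ℝ) : |clip C x| ≤ C := by
  unfold clip
  exact abs_le.2 ⟨le_max_left _ _, max_le (by linarith) (min_le_left _ _)⟩

lemma sub_clip_abs_le {C x L : ℝ} (hC : 0 ≤ C) (hL : |x| ≤ L) : |x - clip C x| ≤ max (L - C) 0 := by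
  unfold clip
  obtain ⟨h1, h2⟩ := abs_le.1 hL
  rcases le_total C x with h | h
  · rw [min_eq_left h, max_eq_right (by linarith), abs_of_nonneg (by linarith)]
    exact le_max_of_le_left (by linarith)
  · rw [min_eq_right h]
    rcases le_total (-C) x with h' | h'
    · rw [max_eq_right h']; simp
    · rw [max_eq_left h', abs_of_nonpos (by linarith)]
      exact le_max_of_le_left (by linarith)

lemma clip_measurable (C : ℝ) : Measurable (clip C) :=
  measurable_const.max (measurable_const.min measurable_id)

lemma tail_small {α : Type*} {mα : MeasurableSpace α} {μ : Measure α} [IsProbabilityMeasure μ]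
    {L : α → ℝ} (hL : Integrable L μ) (δ : ℝ) (hδ : 0 < δ) :
    ∃ C : ℝ, 0 ≤ C ∧ ∫ ω, max (L ω - C) 0 ∂μ ≤ δ := by
  have : Tendsto (fun C : ℕ => ∫ ω, max (L ω - C) 0 ∂μ) atTop (𝓝 (∫ _, (0 : ℝ) ∂μ)) := by
    refine tendsto_integral_of_dominated_convergence (fun ω => |L ω|)
      (fun C => ((hL.sub (integrable_const _)).pos_part).aestronglyMeasurable) hL.abs ?_ ?_
    · intro C
      refine Eventually.of_forall fun ω => ?_
      rw [Real.norm_eq_abs, abs_of_nonneg (le_max_right _ _)]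
      have : (0 : ℝ) ≤ C := Nat.cast_nonneg C
      exact max_le (by linarith [le_abs_self (L ω)]) (abs_nonneg _)
    · refine Eventually.of_forall fun ω => ?_
      refine tendsto_const_nhds.congr' ?_
      filter_upwards [eventually_ge_atTop ⌈L ω⌉₊] with C hC
      have : L ω ≤ C := (Nat.le_ceil _).trans (by exact_mod_cast hC)
      rw [max_eq_right (by linarith)]
  rw [integral_zero] at this
  obtain ⟨C, hC⟩ := (this.eventually (eventually_le_nhds hδ)).exists
  exact ⟨C, Nat.cast_nonneg C, hC⟩

lemma abs_condExp_le_of_dom {α : Type*} (m : MeasurableSpace α) {mα : MeasurableSpace α}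
    {μ : Measure α} {b ψ : α → ℝ} (hb : Integrable b μ) (hψ : Integrable ψ μ)
    (h : ∀ ω, |b ω| ≤ ψ ω) : ∀ᵐ ω ∂μ, |(μ[b | m]) ω| ≤ (μ[ψ | m]) ω := by
  have h1 : μ[b | m] ≤ᵐ[μ] μ[ψ | m] := condExp_mono hb hψ
    (Eventually.of_forall fun ω => (le_abs_self _).trans (h ω))
  have h2 : μ[-ψ | m] ≤ᵐ[μ] μ[b | m] := condExp_mono hψ.neg hb
    (Eventually.of_forall fun ω => (abs_le.1 (h ω)).1)
  filter_upwards [h1, h2, condExp_neg ψ m (μ := μ)] with ω h1 h2 h3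
  rw [h3] at h2
  exact abs_le.2 ⟨h2, h1⟩

lemma step {Ω U : Type*} (Y X : MeasurableSpace Ω) [m0 : MeasurableSpace Ω] [MeasurableSpace U]
    (P : Measure Ω) [IsProbabilityMeasure P]
    (T S : Ω → Ω) (hT : MeasurePreserving T P P) (hS : MeasurePreserving S P P)
    (hST : Function.LeftInverse S T) (hTS : Function.RightInverse S T)
    (ℓ : U → Ω → ℝ) (hℓ : Measurable fun p : U × Ω => ℓ p.1 p.2)
    (Λ : Ω → ℝ) (hΛ : Integrable Λ P) (hdom : ∀ u ω, |ℓ u ω| ≤ Λ ω)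
    (hY : Y ≤ m0) (hX : X ≤ m0) (hX1 : X ≤ MeasurableSpace.comap T X)
    (u : ℕ → Ω → U) (hu : Admissible T S Y u) (m : ℤ) :
    ∀ᵐ ω ∂P, Tendsto
      (fun N : ℕ => (N : ℝ)⁻¹ * ∑ k ∈ Finset.Icc 1 N,
        ((P[lossAt T S ℓ (k : ℤ) (u k) | GG T S Y X k m]) ω -
         (P[lossAt T S ℓ (k : ℤ) (u k) | GG T S Y X k (m + 1)]) ω))
      atTop (𝓝 0) := by
  have hmp := iter_mp hT hS
  have him : ∀ j, Measurable (iter T S j) := fun j => (hmp j).measurable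
  have hGle : ∀ k n, GG T S Y X k n ≤ m0 := GG_le_m Y X him hY hX
  set f : ℕ → Ω → ℝ := fun k => lossAt T S ℓ ((k + 1 : ℕ) : ℤ) (u (k + 1)) with hf
  have hfm : ∀ k, Measurable (f k) := fun k => by
    have h1 : Measurable (u (k + 1)) :=
      (hu (k + 1) (by omega)).mono (obsField_le_m Y him hY _ _) le_rfl
    exact hℓ.comp (h1.prodMk (him ((k + 1 : ℕ) : ℤ)))
  have hfdom : ∀ k ω, |f k ω| ≤ Λ (iter T S ((k + 1 : ℕ) : ℤ) ω) := fun k ω => hdom _ _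
  have hfi : ∀ k, Integrable (f k) P := fun k =>
    Integrable.mono' (((hmp _).integrable_comp hΛ.aestronglyMeasurable).2 hΛ)
      (hfm k).aestronglyMeasurable (Eventually.of_forall (hfdom k))
  have hF1 : ∀ k : ℕ, GG T S Y X k m ≤ GG T S Y X ((k + 1 : ℕ) : ℤ) (m + 1) := fun k => by
    refine sup_le_sup (obsFieldLE_mono T S Y (by push_cast; omega)) (le_of_eq ?_)
    congr 2; push_cast; ring
  have hF2 : ∀ k : ℕ, GG T S Y X ((k + 1 : ℕ) : ℤ) (m + 1) ≤ GG T S Y X ((k + 1 : ℕ) : ℤ) m :=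
      fun k => by
    refine sup_le_sup le_rfl ((comap_iter_mono hST hTS hX1 _).trans (le_of_eq ?_))
    congr 2; ring
  let F : Filtration ℕ m0 :=
    { seq := fun k => GG T S Y X k m
      mono' := monotone_nat_of_le_succ fun k => (hF1 k).trans (hF2 k)
      le' := fun k => hGle _ _ }
  have hcomapG : ∀ (k : ℕ) (n : ℤ) (ψ : Ω → ℝ), Integrable ψ P →
      P[fun ω => ψ (iter T S (k : ℤ) ω) | GG T S Y X k n] =ᵐ[P]
        fun ω => (P[ψ | GG T S Y X 0 n]) (iter T S (k : ℤ) ω) := by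
    intro k n ψ hψ
    have := condExp_comp_mp (GG T S Y X 0 n) (hmp (k : ℤ)) (hGle _ _) ψ hψ
    rwa [comap_GG hST hTS] at this
  have main := avg_tendsto_of_approx hT
    (fun k ω => (P[f k | GG T S Y X ((k + 1 : ℕ) : ℤ) m]) ω -
      (P[f k | GG T S Y X ((k + 1 : ℕ) : ℤ) (m + 1)]) ω) ?_
  · filter_upwards [main] with ω hω
    refine hω.congr fun N => ?_
    congr 1
    rw [Finset.range_eq_Ico, Finset.sum_Ico_add' (fun k : ℕ =>
      ((P[lossAt T S ℓ (k : ℤ) (u k) | GG T S Y X k m]) ω -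
         (P[lossAt T S ℓ (k : ℤ) (u k) | GG T S Y X k (m + 1)]) ω)) 0 N 1]
    rfl
  intro δ hδ
  obtain ⟨C, hC0, hCδ⟩ := tail_small hΛ (δ / 2) (half_pos hδ)
  set ψ : Ω → ℝ := fun ω => max (Λ ω - C) 0 with hψ
  have hψi : Integrable ψ P := (hΛ.sub (integrable_const _)).pos_part
  have hψ0 : ∀ ω, 0 ≤ ψ ω := fun ω => le_max_right _ _
  set a : ℕ → Ω → ℝ := fun k ω => clip C (f k ω) with ha
  set b : ℕ → Ω → ℝ := fun k ω => f k ω - clip C (f k ω) with hb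
  have ham : ∀ k, Measurable (a k) := fun k => (clip_measurable C).comp (hfm k)
  have hai : ∀ k, Integrable (a k) P := fun k =>
    Integrable.mono' (integrable_const C) (ham k).aestronglyMeasurable
      (Eventually.of_forall fun ω => clip_abs_le hC0 _)
  have hbi : ∀ k, Integrable (b k) P := fun k => (hfi k).sub (hai k)
  have hfab : ∀ k, f k = a k + b k := fun k => by ext ω; simp [ha, hb]
  have hbψ : ∀ k ω, |b k ω| ≤ ψ (iter T S ((k + 1 : ℕ) : ℤ) ω) := fun k ω =>
    sub_clip_abs_le hC0 (hfdom k ω)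
  have hcbd : ∀ k (G : MeasurableSpace Ω), ∀ᵐ ω ∂P, |(P[a k | G]) ω| ≤ C := fun k G =>
    ae_bdd_abs_condExp_of_ae_bdd_abs (R := C)
      (Eventually.of_forall fun ω => clip_abs_le hC0 _)
  have hbb : ∀ k n, ∀ᵐ ω ∂P, |(P[b k | GG T S Y X ((k + 1 : ℕ) : ℤ) n]) ω| ≤
      |(P[ψ | GG T S Y X 0 n]) (T (T^[k] ω))| := by
    intro k n
    have hψc : Integrable (fun ω => ψ (iter T S ((k + 1 : ℕ) : ℤ) ω)) P :=
      ((hmp _).integrable_comp hψi.aestronglyMeasurable).2 hψi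
    filter_upwards [abs_condExp_le_of_dom (GG T S Y X ((k + 1 : ℕ) : ℤ) n) (hbi k) hψc (hbψ k),
      hcomapG (k + 1) n ψ hψi] with ω h1 h2
    rw [h2, iter_natCast, Function.iterate_succ_apply'] at h1
    exact h1.trans (le_abs_self _)
  have hcm : ∀ n, Measurable (fun ω => |(P[ψ | GG T S Y X 0 n]) (T ω)|) := fun n => by
    have := ((stronglyMeasurable_condExp (μ := P) (f := ψ) (m := GG T S Y X 0 n)).mono
      (hGle _ _)).measurable
    exact (this.comp hT.measurable).abs
  have hci : ∀ n, Integrable (fun ω => |(P[ψ | GG T S Y X 0 n]) (T ω)|) P := fun n =>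
    ((hT.integrable_comp integrable_condExp.aestronglyMeasurable).2 integrable_condExp).abs
  have hcint : ∀ n, ∫ ω, |(P[ψ | GG T S Y X 0 n]) (T ω)| ∂P ≤ δ / 2 := fun n => by
    have h1 := integral_map (μ := P) hT.measurable.aemeasurable
      (f := fun ω => |(P[ψ | GG T S Y X 0 n]) ω|)
      (by rw [hT.map_eq]; exact integrable_condExp.abs.aestronglyMeasurable)
    rw [hT.map_eq] at h1
    rw [← h1]
    refine (integral_abs_condExp_le ψ).trans (le_trans (le_of_eq ?_) hCδ)
    congr 1; ext ω; exact abs_of_nonneg (hψ0 ω)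
  refine ⟨fun k ω => (P[a k | GG T S Y X ((k + 1 : ℕ) : ℤ) m]) ω -
      (P[a k | GG T S Y X ((k + 1 : ℕ) : ℤ) (m + 1)]) ω,
    fun k ω => (P[b k | GG T S Y X ((k + 1 : ℕ) : ℤ) m]) ω -
      (P[b k | GG T S Y X ((k + 1 : ℕ) : ℤ) (m + 1)]) ω,
    fun ω => |(P[ψ | GG T S Y X 0 m]) (T ω)| + |(P[ψ | GG T S Y X 0 (m + 1)]) (T ω)|,
    ?_, ?_, ?_, (hcm m).add (hcm _), (hci m).add (hci _), fun ω => by positivity, ?_⟩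
  · intro k
    filter_upwards [condExp_add (hai k) (hbi k) (GG T S Y X ((k + 1 : ℕ) : ℤ) m),
      condExp_add (hai k) (hbi k) (GG T S Y X ((k + 1 : ℕ) : ℤ) (m + 1))] with ω h1 h2
    rw [hfab, h1, h2]
    simp only [Pi.add_apply]; ring
  · refine mds_slln P F _ (2 * C) ?_ ?_ ?_
    · intro k
      exact StronglyMeasurable.sub (stronglyMeasurable_condExp)
        (stronglyMeasurable_condExp.mono (hF2 k))
    · intro k
      filter_upwards [hcbd k (GG T S Y X ((k + 1 : ℕ) : ℤ) m),
        hcbd k (GG T S Y X ((k + 1 : ℕ) : ℤ) (m + 1))] with ω h1 h2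
      refine (abs_sub _ _).trans ?_
      linarith
    · intro k
      have e1 : P[P[a k | GG T S Y X ((k + 1 : ℕ) : ℤ) m] | GG T S Y X k m] =ᵐ[P]
          P[a k | GG T S Y X k m] :=
        condExp_condExp_of_le ((hF1 k).trans (hF2 k)) (hGle _ _)
      have e2 : P[P[a k | GG T S Y X ((k + 1 : ℕ) : ℤ) (m + 1)] | GG T S Y X k m] =ᵐ[P]
          P[a k | GG T S Y X k m] :=
        condExp_condExp_of_le (hF1 k) (hGle _ _)
      have e3 := condExp_sub (μ := P)
        (integrable_condExp (f := a k) (μ := P) (m := GG T S Y X ((k + 1 : ℕ) : ℤ) m))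
        (integrable_condExp (f := a k) (μ := P) (m := GG T S Y X ((k + 1 : ℕ) : ℤ) (m + 1)))
        (GG T S Y X k m)
      refine EventuallyEq.trans e3 ?_
      filter_upwards [e1, e2] with ω h1 h2
      rw [Pi.sub_apply, h1, h2, sub_self]; rfl
  · intro k
    filter_upwards [hbb k m, hbb k (m + 1)] with ω h1 h2
    refine (abs_sub _ _).trans ?_
    linarith
  · rw [integral_add (hci m) (hci _)]
    linarith [hcint m, hcint (m + 1)]

lemma steps {Ω U : Type*} (Y X : MeasurableSpace Ω) [m0 : MeasurableSpace Ω] [MeasurableSpace U]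
    (P : Measure Ω) [IsProbabilityMeasure P]
    (T S : Ω → Ω) (hT : MeasurePreserving T P P) (hS : MeasurePreserving S P P)
    (hST : Function.LeftInverse S T) (hTS : Function.RightInverse S T)
    (ℓ : U → Ω → ℝ) (hℓ : Measurable fun p : U × Ω => ℓ p.1 p.2)
    (Λ : Ω → ℝ) (hΛ : Integrable Λ P) (hdom : ∀ u ω, |ℓ u ω| ≤ Λ ω)
    (hY : Y ≤ m0) (hX : X ≤ m0) (hX1 : X ≤ MeasurableSpace.comap T X)
    (u : ℕ → Ω → U) (hu : Admissible T S Y u) (m : ℤ) (r : ℕ) :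
    ∀ᵐ ω ∂P, Tendsto
      (fun N : ℕ => (N : ℝ)⁻¹ * ∑ k ∈ Finset.Icc 1 N,
        ((P[lossAt T S ℓ (k : ℤ) (u k) | GG T S Y X k m]) ω -
         (P[lossAt T S ℓ (k : ℤ) (u k) | GG T S Y X k (m + r)]) ω))
      atTop (𝓝 0) := by
  induction r with
  | zero => simp
  | succ r ih =>
    have h := step Y X P T S hT hS hST hTS ℓ hℓ Λ hΛ hdom hY hX hX1 u hu (m + r)
    filter_upwards [ih, h] with ω h1 h2
    have h3 := h1.add h2
    rw [add_zero] at h3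
    refine h3.congr fun N => ?_
    rw [← mul_add, ← Finset.sum_add_distrib]
    congr 1
    refine Finset.sum_congr rfl fun k _ => ?_
    have : m + ((r + 1 : ℕ) : ℤ) = m + r + 1 := by push_cast; ring
    rw [this]
    ring

end Helpers

/-- Lemma 4.1: with `𝒢ₖⁿ = 𝒴_{-∞,k} ∨ T^{n-k}𝒳`, for every admissible
strategy `u` and all `m, n ∈ ℤ`, the Cesàro averages of
`E[ℓ_k(u_k)|𝒢ₖᵐ] − E[ℓ_k(u_k)|𝒢ₖⁿ]` converge to `0` a.s. -/
theorem statement14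
    {Ω U : Type*} [m0 : MeasurableSpace Ω] [MeasurableSpace U]
    (P : Measure Ω) [IsProbabilityMeasure P]
    (T S : Ω → Ω) (hT : Ergodic T P) (hS : MeasurePreserving S P P)
    (hST : Function.LeftInverse S T) (hTS : Function.RightInverse S T)
    (ℓ : U → Ω → ℝ) (hℓ : Measurable fun p : U × Ω => ℓ p.1 p.2)
    (Λ : Ω → ℝ) (hΛ : Integrable Λ P) (hdom : ∀ u ω, |ℓ u ω| ≤ Λ ω)
    (Y : MeasurableSpace Ω) (hY : Y ≤ m0)
    (X : MeasurableSpace Ω) (hX : X ≤ m0) (hX1 : X ≤ MeasurableSpace.comap T X)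
    (u : ℕ → Ω → U) (hu : Admissible T S Y u) (m n : ℤ) :
    ∀ᵐ ω ∂P, Tendsto
      (fun N : ℕ => (N : ℝ)⁻¹ * ∑ k ∈ Finset.Icc 1 N,
        ((P[lossAt T S ℓ (k : ℤ) (u k) |
            obsFieldLE T S Y (k : ℤ) ⊔ MeasurableSpace.comap (iter T S ((k : ℤ) - m)) X]) ω -
         (P[lossAt T S ℓ (k : ℤ) (u k) |
            obsFieldLE T S Y (k : ℤ) ⊔ MeasurableSpace.comap (iter T S ((k : ℤ) - n)) X]) ω))
      atTop (𝓝 0) := by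
  rcases le_total m n with h | h
  · obtain ⟨r, rfl⟩ := Int.le.dest h
    exact steps (m0 := m0) Y X P T S hT.toMeasurePreserving hS hST hTS ℓ hℓ Λ hΛ hdom hY hX hX1 u hu m r
  · obtain ⟨r, rfl⟩ := Int.le.dest h
    filter_upwards [steps (m0 := m0) Y X P T S hT.toMeasurePreserving hS hST hTS ℓ hℓ Λ hΛ hdom hY hX hX1
      u hu n r] with ω hω
    have h3 := hω.neg
    rw [neg_zero] at h3
    refine h3.congr fun N => ?_
    rw [← mul_neg, ← Finset.sum_neg_distrib]
    congr 1
    exact Finset.sum_congr rfl fun k _ => neg_sub _ _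

end ErgodicDecisions
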